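/- arXiv:2302.01808 — 2 statements merged into one kernel-verified Lean document; each statement's English description precedes it below -/
import Mathlib

section
/- Let S⃗ be a finite submodular separation system inside a universe of separations and let 𝒫 be a set of profiles of S. Then every oriented separation s_P chosen in the construction of the canonical nested set N(S⃗, 𝒫) is closely related to the profile P for which it was chosen. -/
namespace SepSys

variable {U : Type*} [Lattice U]

/-- `inv` is an order-reversing involution on the universe `U`. -/
def IsInvol (inv : U → U) : Prop :=
  (∀ s, inv (inv s) = s) ∧ ∀ r s : U, r ≤ s → inv s ≤ inv r

/-- `Sv` is a separation system inside the universe `U`: a subset closed under the involution. -/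
def IsSepSys (inv : U → U) (Sv : Set U) : Prop :=
  ∀ s ∈ Sv, inv s ∈ Sv

/-- structural submodularity of a separation system inside a universe -/
def SubmodularSys (Sv : Set U) : Prop :=
  ∀ r ∈ Sv, ∀ s ∈ Sv, r ⊔ s ∈ Sv ∨ r ⊓ s ∈ Sv

/-- the (unoriented) separations underlying `r` and `s` are nested -/
def Nested (inv : U → U) (r s : U) : Prop :=
  r ≤ s ∨ r ≤ inv s ∨ inv r ≤ s ∨ inv r ≤ inv s

def NestedSet (inv : U → U) (N : Set U) : Prop :=
  ∀ r ∈ N, ∀ s ∈ N, Nested inv r s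

def NestedWithAll (inv : U → U) (M : Set U) (s : U) : Prop :=
  ∀ m ∈ M, Nested inv s m

/-- `N` represents a set of unoriented separations of `Sv`:
we represent such a set by the set of all orientations of its elements. -/
def UnorientedIn (inv : U → U) (Sv N : Set U) : Prop :=
  N ⊆ Sv ∧ ∀ s ∈ N, inv s ∈ N

/-- `O` is an orientation of (the set of unoriented separations of) `Sv` -/
def IsOrientation (inv : U → U) (Sv O : Set U) : Prop :=
  O ⊆ Sv ∧ (∀ s ∈ Sv, s ∈ O ∨ inv s ∈ O) ∧ ∀ s ∈ O, inv s ∈ O → inv s = s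

def Consistent (inv : U → U) (O : Set U) : Prop :=
  ∀ a ∈ O, ∀ b ∈ O, a ≠ b → ¬ inv a < b

def IsProfile (inv : U → U) (Sv P : Set U) : Prop :=
  IsOrientation inv Sv P ∧ Consistent inv P ∧ ∀ r ∈ P, ∀ s ∈ P, inv (r ⊔ s) ∉ P

def IsStarIn (inv : U → U) (Sv σ : Set U) : Prop :=
  σ ⊆ Sv ∧ (∀ s ∈ σ, inv s ≠ s) ∧ ∀ r ∈ σ, ∀ s ∈ σ, r ≠ s → r ≤ inv s

def IsFTangle (inv : U → U) (Sv : Set U) (F : Set (Set U)) (O : Set U) : Prop :=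
  IsOrientation inv Sv O ∧ Consistent inv O ∧ ∀ σ ∈ F, ¬ σ ⊆ O

/-- the non-degenerate separation underlying `s` distinguishes `O` and `O'` -/
def Distinguishes (inv : U → U) (s : U) (O O' : Set U) : Prop :=
  inv s ≠ s ∧ ((s ∈ O ∧ inv s ∈ O') ∨ (inv s ∈ O ∧ s ∈ O'))

def DistinguishesAll (inv : U → U) (N : Set U) (Ps : Set (Set U)) : Prop :=
  ∀ P ∈ Ps, ∀ P' ∈ Ps, P ≠ P' → ∃ s ∈ N, Distinguishes inv s P P'

def CloselyRelated (inv : U → U) (Sv O : Set U) (s : U) : Prop :=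
  s ∈ O ∧ ∀ r ∈ O, s ⊓ r ∈ Sv

def DistinguishesWell (inv : U → U) (Sv P P' : Set U) (s : U) : Prop :=
  (CloselyRelated inv Sv P s ∧ CloselyRelated inv Sv P' (inv s)) ∨
    (CloselyRelated inv Sv P' s ∧ CloselyRelated inv Sv P (inv s))

def GoodFor (inv : U → U) (Sv : Set U) (Ps : Set (Set U)) (s : U) : Prop :=
  ∃ P ∈ Ps, ∃ P' ∈ Ps, P ≠ P' ∧ DistinguishesWell inv Sv P P' s

def MaxElems (O : Set U) : Set U :=
  {x ∈ O | ∀ y ∈ O, x ≤ y → x = y}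

/-- `σ` is a node of the nested set `N` (represented with all orientations of its elements) -/
def IsNode (inv : U → U) (N σ : Set U) : Prop :=
  IsStarIn inv N σ ∧ ∃ O, IsOrientation inv N O ∧ Consistent inv O ∧ σ = MaxElems O

def IsTrivialIn (inv : U → U) (Sv : Set U) (s : U) : Prop :=
  ∃ r ∈ Sv, ({r, inv r} : Set U) ≠ {s, inv s} ∧ s < r ∧ s < inv r

def SmallSep (inv : U → U) (s : U) : Prop := s ≤ inv s

def StandardSet (inv : U → U) (Sv : Set U) (F : Set (Set U)) : Prop :=
  ∀ s ∈ Sv, IsTrivialIn inv Sv s → ({inv s} : Set U) ∈ F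

def Emulates (inv : U → U) (Sv : Set U) (r s : U) : Prop :=
  r ≤ s ∧ ∀ x ∈ Sv, r ≤ x → x ≠ inv r → s ⊔ x ∈ Sv

open Classical in
/-- the shifting map `f↓` -/
noncomputable def shiftMap (inv : U → U) (r s x : U) : U :=
  if r ≤ x then x ⊔ s else inv (inv x ⊔ s)

def ClosedUnderShifting (inv : U → U) (Sv : Set U) (F : Set (Set U)) : Prop :=
  ∀ r ∈ Sv, ∀ s ∈ Sv, inv r ≠ r → ¬ IsTrivialIn inv Sv r → Emulates inv Sv r s →
    ∀ σ ∈ F, (∀ x ∈ σ, x ∈ Sv ∧ (r ≤ x ∨ r ≤ inv x) ∧ x ≠ inv r) →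
      (∃ t ∈ σ, r ≤ t) → shiftMap inv r s '' σ ∈ F

def Friendly (inv : U → U) (Sv : Set U) (F : Set (Set U)) : Prop :=
  (∀ σ ∈ F, IsStarIn inv Sv σ) ∧ StandardSet inv Sv F ∧
    ClosedUnderShifting inv Sv F ∧
    (∀ s ∈ Sv, SmallSep inv s → ({inv s} : Set U) ∈ F) ∧
    ∀ O, IsFTangle inv Sv F O → IsProfile inv Sv O

def IsAut (inv : U → U) (Sv : Set U) (φ : U → U) : Prop :=
  Set.BijOn φ Sv Sv ∧ (∀ r ∈ Sv, ∀ s ∈ Sv, (r ≤ s ↔ φ r ≤ φ s)) ∧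
    ∀ s ∈ Sv, φ (inv s) = inv (φ s)

/-- the separations of `Sv` that are nested with all separations in `M` -/
def SvM (inv : U → U) (Sv M : Set U) : Set U :=
  {s ∈ Sv | NestedWithAll inv M s}

/-- the set `E_P` of `P`-exclusive separations in `P_M` distinguishing `P` well
from some other profile in `Ps` -/
def EP (inv : U → U) (Sv M : Set U) (Ps : Set (Set U)) (P : Set U) : Set U :=
  {s ∈ P ∩ SvM inv Sv M | (∀ P' ∈ Ps, s ∈ P' → P' = P) ∧
    ∃ P' ∈ Ps, P' ≠ P ∧ DistinguishesWell inv Sv P P' s}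

/-- the set `M_{P,i}` from the construction of the canonical nested set:
separations nested with the previously chosen set `N` that are `P`-exclusive
for the remaining profiles `Q` and maximal in `P ∩ S⃗_i` -/
def MpOf (inv : U → U) (Sv N : Set U) (Q : Set (Set U)) (P : Set U) : Set U :=
  {s ∈ SvM inv Sv N | s ∈ P ∧ (∀ P' ∈ Q, s ∈ P' → P' = P) ∧
    ∀ x ∈ P ∩ SvM inv Sv N, s ≤ x → s = x}

def QiOf (inv : U → U) (Sv N : Set U) (Q : Set (Set U)) : Set (Set U) :=
  {P ∈ Q | (MpOf inv Sv N Q P).Nonempty}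

/-- step `i` of the construction: the pair `(N_i, Ps_{≥ i+1})` -/
def constrStep (inv : U → U) (Sv : Set U) (Ps : Set (Set U)) : ℕ → Set U × Set (Set U)
  | 0 => (∅, Ps)
  | (i+1) =>
      let p := constrStep inv Sv Ps i
      (p.1 ∪ {x | ∃ P ∈ QiOf inv Sv p.1 p.2, ∃ y,
          IsGLB (MpOf inv Sv p.1 p.2 P) y ∧ (x = y ∨ x = inv y)},
        p.2 \ QiOf inv Sv p.1 p.2)

/-- the least `K` such that `Ps_{≥ K+1}` contains at most one profile -/
noncomputable def stopIndex (inv : U → U) (Sv : Set U) (Ps : Set (Set U)) : ℕ :=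
  sInf {i | ((constrStep inv Sv Ps i).2).Subsingleton}

/-- the canonical nested set `N(S⃗, Ps)` -/
noncomputable def canonicalN (inv : U → U) (Sv : Set U) (Ps : Set (Set U)) : Set U :=
  (constrStep inv Sv Ps (stopIndex inv Sv Ps)).1

end SepSys

open SepSys

namespace SepSys

variable {U : Type*} [Lattice U] {inv : U → U} {Sv : Set U}

theorem IsInvol.le_inv_comm (hinv : IsInvol inv) {r s : U} : r ≤ inv s ↔ s ≤ inv r :=
  ⟨fun h => by simpa [hinv.1] using hinv.2 _ _ h, fun h => by simpa [hinv.1] using hinv.2 _ _ h⟩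

theorem IsInvol.inv_le_comm (hinv : IsInvol inv) {r s : U} : inv r ≤ s ↔ inv s ≤ r :=
  ⟨fun h => by simpa [hinv.1] using hinv.2 _ _ h, fun h => by simpa [hinv.1] using hinv.2 _ _ h⟩

theorem IsInvol.inv_inf (hinv : IsInvol inv) (r s : U) : inv (r ⊓ s) = inv r ⊔ inv s := by
  apply le_antisymm
  · rw [hinv.inv_le_comm]
    exact le_inf (hinv.inv_le_comm.1 le_sup_left) (hinv.inv_le_comm.1 le_sup_right)
  · exact sup_le (hinv.2 _ _ inf_le_left) (hinv.2 _ _ inf_le_right)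

theorem Nested.symm (hinv : IsInvol inv) {r s : U} (h : Nested inv r s) : Nested inv s r := by
  rcases h with h | h | h | h
  · exact Or.inr (Or.inr (Or.inr (hinv.2 _ _ h)))
  · exact Or.inr (Or.inl (hinv.le_inv_comm.1 h))
  · exact Or.inr (Or.inr (Or.inl (hinv.inv_le_comm.1 h)))
  · exact Or.inl (by simpa [hinv.1] using hinv.2 _ _ h)

theorem Nested.inv_right (hinv : IsInvol inv) {r s : U} (h : Nested inv r s) :
    Nested inv r (inv s) := by
  simp only [Nested, hinv.1] at *
  tauto

namespace IsProfile

variable {P : Set U}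

theorem mem_sys (hP : IsProfile inv Sv P) {r : U} (hr : r ∈ P) : r ∈ Sv := hP.1.1 hr

theorem inv_notMem (hP : IsProfile inv Sv P) {r : U} (hr : r ∈ P) : inv r ∉ P := by
  simpa using hP.2.2 r hr r hr

theorem mem_or (hP : IsProfile inv Sv P) {r : U} (hr : r ∈ Sv) : r ∈ P ∨ inv r ∈ P :=
  hP.1.2.1 r hr

theorem sup_mem (hP : IsProfile inv Sv P) {r s : U} (hr : r ∈ P) (hs : s ∈ P)
    (h : r ⊔ s ∈ Sv) : r ⊔ s ∈ P :=
  (hP.mem_or h).resolve_right (hP.2.2 r hr s hs)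

theorem not_inv_le (hP : IsProfile inv Sv P) {r s : U} (hr : r ∈ P) (hs : s ∈ P) (hne : r ≠ s) :
    ¬ inv r ≤ s := by
  intro h
  rcases h.lt_or_eq with h | h
  · exact hP.2.1 r hr s hs hne h
  · exact hP.inv_notMem hr (h ▸ hs)

theorem mem_of_le (hinv : IsInvol inv) (hP : IsProfile inv Sv P) {r s : U} (hr : r ∈ Sv)
    (hs : s ∈ P) (h : r ≤ s) (hne : inv r ≠ s) : r ∈ P := by
  by_contra hrP
  have hr' := (hP.mem_or hr).resolve_left hrP
  exact hP.not_inv_le hr' hs hne (by rwa [hinv.1])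

theorem inf_mem (hinv : IsInvol inv) (hP : IsProfile inv Sv P) {r s : U} (hr : r ∈ P)
    (hs : s ∈ P) (h : r ⊓ s ∈ Sv) : r ⊓ s ∈ P := by
  by_cases h1 : inv (r ⊓ s) = r
  · by_cases h2 : inv (r ⊓ s) = s
    · have : r = s := h1.symm.trans h2
      subst this
      simpa using hr
    · exact hP.mem_of_le hinv h hs inf_le_right h2
  · exact hP.mem_of_le hinv h hr inf_le_left h1

end IsProfile

/-- The data accumulated by the construction before a step: `T` contains, for each separation
chosen so far, the orientation shared by all profiles in `Q`. -/
structure StageData (inv : U → U) (Sv N : Set U) (Q : Set (Set U)) (T : Set U) : Prop where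
  mem_iff : ∀ x, x ∈ N ↔ x ∈ T ∨ inv x ∈ T
  sub_sys : T ⊆ Sv
  nested : ∀ r ∈ T, ∀ s ∈ T, Nested inv r s
  profile : ∀ P ∈ Q, IsProfile inv Sv P
  mem_profile : ∀ t ∈ T, ∀ P ∈ Q, t ∈ P
  close : ∀ t ∈ T, ∃ P, IsProfile inv Sv P ∧ CloselyRelated inv Sv P (inv t)

namespace StageData

variable {N T P R : Set U} {Q : Set (Set U)}

theorem mem_SvM (hinv : IsInvol inv) (hD : StageData inv Sv N Q T) {x : U} (hx : x ∈ Sv)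
    (h : ∀ t ∈ T, Nested inv x t) : x ∈ SvM inv Sv N := by
  refine ⟨hx, fun t ht => ?_⟩
  rcases (hD.mem_iff t).1 ht with ht | ht
  · exact h t ht
  · simpa [hinv.1] using (h _ ht).inv_right hinv

theorem mem_SvM_of_le (hinv : IsInvol inv) (hD : StageData inv Sv N Q T) {x : U} (hx : x ∈ Sv)
    (h : ∀ t ∈ T, x ≤ inv t ∨ t ≤ x) : x ∈ SvM inv Sv N :=
  hD.mem_SvM hinv hx fun t ht => (h t ht).elim (fun h => Or.inr (Or.inl h))
    (fun h => Or.inr (Or.inr (Or.inr (hinv.2 _ _ h))))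

theorem le_inv_or_le (hinv : IsInvol inv) (hD : StageData inv Sv N Q T) (hQ : Q.Nontrivial)
    (hP : P ∈ Q) {m : U} (hm : m ∈ MpOf inv Sv N Q P) {t : U} (ht : t ∈ T) :
    m ≤ inv t ∨ t ≤ m := by
  obtain ⟨R, hR, hRP⟩ := hQ.exists_ne P
  have hne : m ≠ t := by
    rintro rfl
    exact hRP (hm.2.2.1 R hR (hD.mem_profile _ ht R hR))
  have htS : t ∈ SvM inv Sv N := hD.mem_SvM hinv (hD.sub_sys ht) fun u hu => hD.nested t ht u hu
  have htP := hD.mem_profile t ht P hP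
  rcases hm.1.2 t ((hD.mem_iff t).2 (Or.inl ht)) with h | h | h | h
  · exact absurd (hm.2.2.2 t ⟨htP, htS⟩ h) hne
  · exact Or.inl h
  · exact absurd h ((hD.profile P hP).not_inv_le hm.2.1 htP hne)
  · exact Or.inr (by simpa [hinv.1] using hinv.2 _ _ h)

theorem exists_reduced (hinv : IsInvol inv) (hfin : Sv.Finite) (hD : StageData inv Sv N Q T)
    (hP : P ∈ Q) (m : U) {r : U} (hr : r ∈ P) :
    ∃ r' ∈ P, m ⊓ r' = m ⊓ r ∧ ∀ t ∈ T, m ≤ inv t → r' ≤ inv t ∨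
      ∃ P', IsProfile inv Sv P' ∧ CloselyRelated inv Sv P' (inv t) ∧ inv r' ∈ P' := by
  have hPp := hD.profile P hP
  obtain ⟨r', hr'⟩ := ((hfin.subset hPp.1.1).subset
    (Set.sep_subset P (fun x => m ⊓ x = m ⊓ r))).exists_minimal ⟨r, hr, rfl⟩
  refine ⟨r', hr'.1.1, hr'.1.2, fun t ht hmt => ?_⟩
  obtain ⟨P', hP', hc⟩ := hD.close t ht
  rcases hP'.mem_or (hPp.mem_sys hr'.1.1) with h | h
  · left
    have hS := hc.2 r' h
    have hmem : inv t ⊓ r' ∈ P := by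
      refine hPp.mem_of_le hinv hS hr'.1.1 inf_le_right fun he => ?_
      exact hP'.inv_notMem (hP'.inf_mem hinv hc.1 h hS) (by rwa [he])
    have := hr'.2 (y := inv t ⊓ r')
      ⟨hmem, by rw [← inf_assoc, inf_eq_left.2 hmt, hr'.1.2]⟩ inf_le_right
    exact this.trans inf_le_left
  · exact Or.inr ⟨P', hP', hc, h⟩

theorem inf_mem_sys (hinv : IsInvol inv) (hfin : Sv.Finite) (hsys : IsSepSys inv Sv)
    (hsub : SubmodularSys Sv) (hD : StageData inv Sv N Q T) (hQ : Q.Nontrivial) (hP : P ∈ Q)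
    {m : U} (hm : m ∈ MpOf inv Sv N Q P) {r₀ : U} (hr₀ : r₀ ∈ P) : m ⊓ r₀ ∈ Sv := by
  have hPp := hD.profile P hP
  obtain ⟨r, hr, hmr, hrT⟩ := hD.exists_reduced hinv hfin hP m hr₀
  rw [← hmr]
  by_contra hcon
  have hsup : m ⊔ r ∈ P :=
    hPp.sup_mem hm.2.1 hr ((hsub m hm.1.1 r (hPp.mem_sys hr)).resolve_right hcon)
  obtain ⟨x, hx⟩ := ((hfin.subset hPp.1.1).subset (Set.sep_subset P (fun x => m ⊔ r ≤ x ∧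
    ∀ t ∈ T, m ≤ inv t → r ≤ inv t → x ≤ inv t ∨ t ≤ x))).exists_maximal
    ⟨m ⊔ r, hsup, le_rfl, fun t _ h1 h2 => Or.inl (sup_le h1 h2)⟩
  obtain ⟨hxP, hxle, hxT⟩ := hx.1
  have hall : ∀ t ∈ T, x ≤ inv t ∨ t ≤ x := by
    intro t ht
    rcases hD.le_inv_or_le hinv hQ hP hm ht with hmt | hmt
    swap
    · exact Or.inr (hmt.trans (le_sup_left.trans hxle))
    by_cases hrt : r ≤ inv t
    · exact hxT t ht hmt hrt
    right
    obtain ⟨P', hP', hc, hrP'⟩ := (hrT t ht hmt).resolve_left hrt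
    have hxP' : inv x ∈ P' := by
      refine hP'.mem_of_le hinv (hsys _ (hPp.mem_sys hxP)) hrP'
        (hinv.2 _ _ (le_sup_right.trans hxle)) fun he => ?_
      rw [hinv.1] at he
      exact hPp.inv_notMem hr (he ▸ hxP)
    have hS : t ⊔ x ∈ Sv := by
      simpa [hinv.inv_inf, hinv.1] using hsys _ (hc.2 _ hxP')
    have htP := hD.mem_profile t ht P hP
    refine le_sup_left.trans (hx.2 (y := t ⊔ x)
      ⟨hPp.sup_mem htP hxP hS, hxle.trans le_sup_right, fun u hu hmu hru => ?_⟩ le_sup_right)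
    rcases hxT u hu hmu hru with h | h
    · have hne : t ≠ u := fun e => hrt (e ▸ hru)
      rcases hD.nested t ht u hu with h' | h' | h' | h'
      · exact absurd (hru.trans (hinv.2 _ _ h')) hrt
      · exact Or.inl (sup_le h' h)
      · exact absurd h' (hPp.not_inv_le htP (hD.mem_profile u hu P hP) hne)
      · exact Or.inr (le_trans (by simpa [hinv.1] using hinv.2 _ _ h') le_sup_left)
    · exact Or.inr (h.trans le_sup_right)
  have hmx : m = x := hm.2.2.2 x ⟨hxP, hD.mem_SvM_of_le hinv (hPp.mem_sys hxP) hall⟩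
    (le_sup_left.trans hxle)
  apply hcon
  rw [inf_eq_right.2 (hmx ▸ le_sup_right.trans hxle)]
  exact hPp.mem_sys hr

theorem closelyRelated (hinv : IsInvol inv) (hfin : Sv.Finite) (hsys : IsSepSys inv Sv)
    (hsub : SubmodularSys Sv) (hD : StageData inv Sv N Q T) (hQ : Q.Nontrivial)
    (hP : P ∈ QiOf inv Sv N Q) {s : U} (hs : IsGLB (MpOf inv Sv N Q P) s) :
    CloselyRelated inv Sv P s := by
  have hPp := hD.profile P hP.1
  have key : ∀ r ∈ P, s ⊓ r ∈ P := by
    intro r hr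
    obtain ⟨x, hx⟩ := ((hfin.subset hPp.1.1).subset
      (Set.sep_subset P (fun x => s ⊓ r ≤ x ∧ x ≤ r))).exists_minimal ⟨r, hr, inf_le_right, le_rfl⟩
    obtain ⟨hxP, h1, h2⟩ := hx.1
    have hxs : x ≤ s := hs.2 fun m hm => by
      have hmx := hPp.inf_mem hinv hm.2.1 hxP (hD.inf_mem_sys hinv hfin hsys hsub hQ hP.1 hm hxP)
      exact (hx.2 (y := m ⊓ x) ⟨hmx, le_inf (inf_le_left.trans (hs.1 hm)) h1,
        inf_le_right.trans h2⟩ inf_le_right).trans inf_le_left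
    rwa [le_antisymm h1 (le_inf hxs h2)]
  obtain ⟨m, hm⟩ := hP.2
  refine ⟨?_, fun r hr => hPp.mem_sys (key r hr)⟩
  simpa [inf_eq_left.2 (hs.1 hm)] using key m hm.2.1

theorem inv_mem_of_mem_MpOf (hD : StageData inv Sv N Q T) (hR : R ∈ Q) (hRP : R ≠ P) {m : U}
    (hm : m ∈ MpOf inv Sv N Q P) : inv m ∈ R :=
  ((hD.profile R hR).mem_or hm.1.1).resolve_left fun h => hRP (hm.2.2.1 R hR h)

theorem inv_mem_of_isGLB (hinv : IsInvol inv) (hfin : Sv.Finite) (hsys : IsSepSys inv Sv)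
    (hsub : SubmodularSys Sv) (hD : StageData inv Sv N Q T) (hQ : Q.Nontrivial)
    (hP : P ∈ QiOf inv Sv N Q) (hR : R ∈ Q) (hRP : R ≠ P) {s : U}
    (hs : IsGLB (MpOf inv Sv N Q P) s) : inv s ∈ R := by
  have hPp := hD.profile P hP.1
  have hRp := hD.profile R hR
  obtain ⟨m₀, hm₀⟩ := hP.2
  obtain ⟨x, hx⟩ := ((hfin.subset hRp.1.1).subset
    (Set.sep_subset R (fun x => inv x ∈ P ∧ x ≤ inv s))).exists_maximal
    ⟨inv m₀, hD.inv_mem_of_mem_MpOf hR hRP hm₀, by simpa [hinv.1] using hm₀.2.1,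
      hinv.2 _ _ (hs.1 hm₀)⟩
  obtain ⟨hxR, hxP, hxs⟩ := hx.1
  have hle : inv x ≤ s := hs.2 fun m hm => by
    have hmx := hPp.inf_mem hinv hm.2.1 hxP (hD.inf_mem_sys hinv hfin hsys hsub hQ hP.1 hm hxP)
    have he : inv (m ⊓ inv x) = inv m ⊔ x := by rw [hinv.inv_inf, hinv.1]
    have hmR := hD.inv_mem_of_mem_MpOf hR hRP hm
    have hS : inv m ⊔ x ∈ Sv := he ▸ hsys _ (hPp.mem_sys hmx)
    exact hinv.inv_le_comm.1 (le_sup_left.trans (hx.2 (y := inv m ⊔ x)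
      ⟨hRp.sup_mem hmR hxR hS, by rwa [← he, hinv.1],
        sup_le (hinv.2 _ _ (hs.1 hm)) hxs⟩ le_sup_right))
  rwa [le_antisymm (hinv.inv_le_comm.1 hle) hxs]

theorem isGLB_le_inv_or_le (hinv : IsInvol inv) (hD : StageData inv Sv N Q T)
    (hQ : Q.Nontrivial) (hP : P ∈ Q) {s : U} (hs : IsGLB (MpOf inv Sv N Q P) s) {t : U}
    (ht : t ∈ T) : s ≤ inv t ∨ t ≤ s := by
  by_cases h : ∃ m ∈ MpOf inv Sv N Q P, m ≤ inv t
  · obtain ⟨m, hm, hmt⟩ := h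
    exact Or.inl ((hs.1 hm).trans hmt)
  · push Not at h
    exact Or.inr (hs.2 fun m hm => (hD.le_inv_or_le hinv hQ hP hm ht).resolve_left (h m hm))

theorem inv_le_of_isGLB (hinv : IsInvol inv) (hfin : Sv.Finite) (hsys : IsSepSys inv Sv)
    (hsub : SubmodularSys Sv) (hD : StageData inv Sv N Q T) (hQ : Q.Nontrivial)
    (hP : P ∈ QiOf inv Sv N Q) (hR : R ∈ QiOf inv Sv N Q) (hRP : R ≠ P) {p q : U}
    (hp : IsGLB (MpOf inv Sv N Q P) p) (hq : IsGLB (MpOf inv Sv N Q R) q) : inv q ≤ p := by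
  refine hp.2 fun m hm => ?_
  have hPp := hD.profile P hP.1
  have hqP : inv q ∈ P := hD.inv_mem_of_isGLB hinv hfin hsys hsub hQ hR hP.1 hRP.symm hq
  have hS : m ⊔ inv q ∈ Sv := by
    have := hsys _ ((hD.closelyRelated hinv hfin hsys hsub hQ hR hq).2 _
      (hD.inv_mem_of_mem_MpOf hR.1 hRP hm))
    rwa [hinv.inv_inf, hinv.1, sup_comm] at this
  have hmem : m ⊔ inv q ∈ SvM inv Sv N := hD.mem_SvM_of_le hinv hS fun t ht => by
    rcases hD.le_inv_or_le hinv hQ hP.1 hm ht with h | h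
    · rcases hD.isGLB_le_inv_or_le hinv hQ hR.1 hq ht with h' | h'
      · exact Or.inr ((hinv.le_inv_comm.1 h').trans le_sup_right)
      · exact Or.inl (sup_le h (hinv.2 _ _ h'))
    · exact Or.inr (h.trans le_sup_left)
  rw [hm.2.2.2 _ ⟨hPp.sup_mem hm.2.1 hqP hS, hmem⟩ le_sup_left]
  exact le_sup_right

theorem step (hinv : IsInvol inv) (hfin : Sv.Finite) (hsys : IsSepSys inv Sv)
    (hsub : SubmodularSys Sv) (hD : StageData inv Sv N Q T) (hQ : Q.Nontrivial) :
    StageData inv Sv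
      (N ∪ {x | ∃ P ∈ QiOf inv Sv N Q, ∃ y,
        IsGLB (MpOf inv Sv N Q P) y ∧ (x = y ∨ x = inv y)})
      (Q \ QiOf inv Sv N Q)
      (T ∪ {x | ∃ P ∈ QiOf inv Sv N Q, IsGLB (MpOf inv Sv N Q P) (inv x)}) where
  mem_iff x := by
    have hx : ∀ y, x = inv y ↔ inv x = y := fun y =>
      ⟨fun h => by rw [h, hinv.1], fun h => by rw [← h, hinv.1]⟩
    simp only [Set.mem_union, Set.mem_ofPred_eq, hD.mem_iff, hinv.1, hx]
    constructor
    · rintro ((h | h) | ⟨P, hP, y, hy, rfl | rfl⟩)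
      exacts [Or.inl (Or.inl h), Or.inr (Or.inl h), Or.inr (Or.inr ⟨P, hP, hy⟩),
        Or.inl (Or.inr ⟨P, hP, hy⟩)]
    · rintro ((h | ⟨P, hP, hy⟩) | (h | ⟨P, hP, hy⟩))
      exacts [Or.inl (Or.inl h), Or.inr ⟨P, hP, _, hy, Or.inr rfl⟩, Or.inl (Or.inr h),
        Or.inr ⟨P, hP, _, hy, Or.inl rfl⟩]
  sub_sys := by
    rintro x (hx | ⟨P, hP, hx⟩)
    · exact hD.sub_sys hx
    · have := (hD.profile P hP.1).mem_sys (hD.closelyRelated hinv hfin hsys hsub hQ hP hx).1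
      simpa [hinv.1] using hsys _ this
  nested := by
    have hTnew : ∀ t ∈ T, ∀ x, ∀ P ∈ QiOf inv Sv N Q, IsGLB (MpOf inv Sv N Q P) (inv x) →
        Nested inv t x := by
      intro t ht x P hP hx
      rcases hD.isGLB_le_inv_or_le hinv hQ hP.1 hx ht with h | h
      · exact Or.inl (by simpa [hinv.1] using hinv.2 _ _ h)
      · exact Or.inr (Or.inl h)
    rintro r (hr | ⟨P, hP, hr⟩) s (hs | ⟨R, hR, hs⟩)
    · exact hD.nested r hr s hs
    · exact hTnew r hr s R hR hs
    · exact (hTnew s hs r P hP hr).symm hinv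
    · by_cases hRP : R = P
      · subst hRP
        exact Or.inr (Or.inr (Or.inr (hs.unique hr).ge))
      · have := hD.inv_le_of_isGLB hinv hfin hsys hsub hQ hP hR hRP hr hs
        exact Or.inr (Or.inl (hinv.le_inv_comm.1 (by rwa [hinv.1] at this)))
  profile P hP := hD.profile P hP.1
  mem_profile := by
    rintro t (ht | ⟨P, hP, ht⟩) R hR
    · exact hD.mem_profile t ht R hR.1
    · have hRP : R ≠ P := by
        rintro rfl
        exact hR.2 hP
      simpa [hinv.1] using hD.inv_mem_of_isGLB hinv hfin hsys hsub hQ hP hR.1 hRP ht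
  close := by
    rintro t (ht | ⟨P, hP, ht⟩)
    · exact hD.close t ht
    · exact ⟨P, hD.profile P hP.1, hD.closelyRelated hinv hfin hsys hsub hQ hP ht⟩

end StageData

theorem nontrivial_of_lt_stopIndex {Ps : Set (Set U)} {i : ℕ} (hi : i < stopIndex inv Sv Ps) :
    ((constrStep inv Sv Ps i).2).Nontrivial :=
  Set.not_subsingleton_iff.1 fun h => Nat.notMem_of_lt_sInf hi h

theorem exists_stageData (hinv : IsInvol inv) (hfin : Sv.Finite) (hsys : IsSepSys inv Sv)
    (hsub : SubmodularSys Sv) {Ps : Set (Set U)} (hPs : ∀ P ∈ Ps, IsProfile inv Sv P) (i : ℕ)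
    (hi : i < stopIndex inv Sv Ps) :
    ∃ T, StageData inv Sv (constrStep inv Sv Ps i).1 (constrStep inv Sv Ps i).2 T := by
  induction i with
  | zero => exact ⟨∅, by simp [constrStep], by simp, by simp, hPs, by simp, by simp⟩
  | succ i ih =>
    have hi' := (Nat.lt_succ_self i).trans hi
    obtain ⟨T, hT⟩ := ih hi'
    exact ⟨_, hT.step hinv hfin hsys hsub (nontrivial_of_lt_stopIndex hi')⟩

end SepSys

theorem construction_sP_closely_related {U : Type*} [Lattice U] (inv : U → U) (Sv : Set U)
    (hinv : IsInvol inv) (hfin : Sv.Finite) (hsys : IsSepSys inv Sv)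
    (hsub : SubmodularSys Sv)
    (Ps : Set (Set U)) (hPs : ∀ P ∈ Ps, IsProfile inv Sv P) :
    ∀ i < stopIndex inv Sv Ps,
      ∀ P ∈ QiOf inv Sv (constrStep inv Sv Ps i).1 (constrStep inv Sv Ps i).2,
        ∀ s : U, IsGLB (MpOf inv Sv (constrStep inv Sv Ps i).1 (constrStep inv Sv Ps i).2 P) s →
          CloselyRelated inv Sv P s := by
  intro i hi P hP s hs
  obtain ⟨T, hT⟩ := exists_stageData hinv hfin hsys hsub hPs i hi
  exact hT.closelyRelated hinv hfin hsys hsub (nontrivial_of_lt_stopIndex hi) hP hs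
end

section
/- Let S⃗ be a finite submodular separation system inside a universe of separations and let 𝒫 be a set of profiles of S. Then for every node σ of the canonical nested set N(S⃗, 𝒫) that is inessential for 𝒫, and for every oriented separation s ∈ σ, the inverse s* is closely related to some profile in 𝒫. -/
open SepSys

namespace SepSys

variable {U : Type*} [Lattice U]

section Involution

variable {inv : U → U}

theorem IsInvol.le_iff (h : IsInvol inv) {a b : U} : inv a ≤ inv b ↔ b ≤ a :=
  ⟨fun hab => by simpa only [h.1] using h.2 _ _ hab, h.2 b a⟩

theorem IsInvol.inv_le (h : IsInvol inv) {a b : U} (hab : inv a ≤ b) : inv b ≤ a := by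
  simpa only [h.1] using h.2 _ _ hab

theorem IsInvol.inv_inf_s11 (h : IsInvol inv) (a b : U) : inv (a ⊓ b) = inv a ⊔ inv b :=
  le_antisymm
    (h.inv_le (le_inf (h.inv_le le_sup_left) (h.inv_le le_sup_right)))
    (sup_le (h.2 _ _ inf_le_left) (h.2 _ _ inf_le_right))

end Involution

section Profile

variable {inv : U → U} {Sv P : Set U}

theorem IsProfile.mem_sys_s11 (hP : IsProfile inv Sv P) {a : U} (ha : a ∈ P) : a ∈ Sv :=
  hP.1.1 ha

theorem IsProfile.inv_notMem_s11 (hP : IsProfile inv Sv P) {a : U} (ha : a ∈ P) : inv a ∉ P := by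
  simpa only [sup_idem] using hP.2.2 a ha a ha

theorem IsProfile.inv_mem (hP : IsProfile inv Sv P) {a : U} (ha : a ∈ Sv) (h : a ∉ P) :
    inv a ∈ P :=
  (hP.1.2.1 a ha).resolve_left h

theorem IsProfile.sup_mem_s11 (hP : IsProfile inv Sv P) {a b : U} (ha : a ∈ P) (hb : b ∈ P)
    (hab : a ⊔ b ∈ Sv) : a ⊔ b ∈ P :=
  (hP.1.2.1 _ hab).resolve_right (hP.2.2 a ha b hb)

/-- Two elements of a profile that point away from each other are equal. -/
theorem IsProfile.eq_of_inv_le (hP : IsProfile inv Sv P) {a b : U} (ha : a ∈ P) (hb : b ∈ P)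
    (hab : inv a ≤ b) : a = b := by
  by_contra hne
  rcases hab.lt_or_eq with h | h
  · exact hP.2.1 a ha b hb hne h
  · exact hP.inv_notMem_s11 ha (h ▸ hb)

theorem IsProfile.inf_mem_s11 (hinv : IsInvol inv) (hP : IsProfile inv Sv P) {a b : U} (ha : a ∈ P)
    (hb : b ∈ P) (hab : a ⊓ b ∈ Sv) : a ⊓ b ∈ P := by
  by_contra h
  have h1 : inv (a ⊓ b) = a :=
    hP.eq_of_inv_le (hP.inv_mem hab h) ha (by rw [hinv.1]; exact inf_le_left)
  have h2 : inv (a ⊓ b) = b :=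
    hP.eq_of_inv_le (hP.inv_mem hab h) hb (by rw [hinv.1]; exact inf_le_right)
  have : a = b := h1.symm.trans h2
  subst this
  exact h (by simpa using ha)

end Profile

/-- The invariant of the construction of the canonical nested set: `N` consists of all
orientations of the separations `w` with `W Q w`, where `w` has been chosen for the profile `Q`,
and `Qs` is the set of the profiles not yet treated. -/
structure Uncrossed (inv : U → U) (Sv N : Set U) (Qs : Set (Set U))
    (W : Set U → U → Prop) : Prop where
  mem_iff : ∀ n, n ∈ N ↔ ∃ Q w, W Q w ∧ (n = w ∨ n = inv w)
  profile : ∀ P ∈ Qs, IsProfile inv Sv P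
  profile_of : ∀ Q w, W Q w → IsProfile inv Sv Q
  related : ∀ Q w, W Q w → CloselyRelated inv Sv Q w
  inv_mem : ∀ Q w, W Q w → ∀ R ∈ Qs, inv w ∈ R
  nested : ∀ Q w Q' w', W Q w → W Q' w' → w ≤ w' ∨ w' ≤ w ∨ inv w ≤ w'

namespace Uncrossed

variable {inv : U → U} {Sv N : Set U} {Qs : Set (Set U)} {W : Set U → U → Prop}

theorem mem_SvM (hinv : IsInvol inv) (hW : Uncrossed inv Sv N Qs W) {z : U} (hz : z ∈ Sv)
    (h : ∀ Q w, W Q w → z ≤ w ∨ inv w ≤ z ∨ z ≤ inv w) : z ∈ SvM inv Sv N := by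
  refine ⟨hz, fun m hm => ?_⟩
  obtain ⟨Q, w, hw, rfl | rfl⟩ := (hW.mem_iff m).1 hm
  · rcases h Q m hw with h | h | h
    · exact Or.inl h
    · exact Or.inr (Or.inr (Or.inl (hinv.inv_le h)))
    · exact Or.inr (Or.inl h)
  · unfold Nested
    rw [hinv.1]
    rcases h Q w hw with h | h | h
    · exact Or.inr (Or.inl h)
    · exact Or.inr (Or.inr (Or.inr (hinv.inv_le h)))
    · exact Or.inl h

theorem inv_mem_SvM (hinv : IsInvol inv) (hsys : IsSepSys inv Sv) (hW : Uncrossed inv Sv N Qs W)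
    {Q : Set U} {w : U} (hw : W Q w) : inv w ∈ SvM inv Sv N := by
  refine hW.mem_SvM hinv (hsys _ ((hW.profile_of Q w hw).mem_sys_s11 (hW.related Q w hw).1)) ?_
  intro Q' w' hw'
  rcases hW.nested Q w Q' w' hw hw' with h | h | h
  · exact Or.inr (Or.inl (hinv.2 _ _ h))
  · exact Or.inr (Or.inr (hinv.2 _ _ h))
  · exact Or.inl h

/-- A maximal exclusive separation points towards or away from each earlier separation. -/
theorem le_or_inv_le (hinv : IsInvol inv) (hsys : IsSepSys inv Sv)
    (hW : Uncrossed inv Sv N Qs W) (hnt : ¬ Qs.Subsingleton) {P : Set U} (hP : P ∈ Qs) {x : U}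
    (hx : x ∈ MpOf inv Sv N Qs P) {Q : Set U} {w : U} (hw : W Q w) :
    x ≤ w ∨ inv w ≤ x := by
  obtain ⟨hxS, hxP, hex, hmax⟩ := hx
  have hne : x ≠ inv w := by
    rintro rfl
    refine hnt fun A hA B hB => ?_
    rw [hex A hA (hW.inv_mem Q w hw A hA), hex B hB (hW.inv_mem Q w hw B hB)]
  have hwN : w ∈ N := (hW.mem_iff w).2 ⟨Q, w, hw, Or.inl rfl⟩
  have hwP := hW.inv_mem Q w hw P hP
  rcases hxS.2 w hwN with h | h | h | h
  · exact Or.inl h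
  · exact absurd (hmax _ ⟨hwP, hW.inv_mem_SvM hinv hsys hw⟩ h) hne
  · exact Or.inr (hinv.inv_le h)
  · exact absurd ((hW.profile P hP).eq_of_inv_le hwP hxP
      (by rw [hinv.1]; exact hinv.le_iff.1 h)).symm hne

theorem maximal_inf_mem (hinv : IsInvol inv) (hfin : Sv.Finite) (hsys : IsSepSys inv Sv)
    (hsub : SubmodularSys Sv) (hW : Uncrossed inv Sv N Qs W) (hnt : ¬ Qs.Subsingleton)
    {P : Set U} (hP : P ∈ Qs) {x : U} (hx : x ∈ MpOf inv Sv N Qs P) :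
    ∀ r ∈ P, x ⊓ r ∈ Sv := by
  by_contra hcon
  push Not at hcon
  have hPP := hW.profile P hP
  have hfinP : P.Finite := hfin.subset hPP.1.1
  obtain ⟨r, ⟨hrP, hrx⟩, hrmin⟩ :=
    (hfinP.subset (Set.sep_subset P fun r => x ⊓ r ∉ Sv)).exists_minimal hcon
  have hside := fun Q w (hw : W Q w) => hW.le_or_inv_le hinv hsys hnt hP hx hw
  obtain ⟨hxS, hxP, -, hmax⟩ := hx
  have hr : ∀ Q w, W Q w → x ≤ w → r ≤ w ∨ inv r ∈ Q := by
    intro Q w hw hxw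
    have hQ := hW.profile_of Q w hw
    obtain ⟨hwQ, hrel⟩ := hW.related Q w hw
    by_cases hrQ : r ∈ Q
    · left
      have hrwS : r ⊓ w ∈ Sv := by rw [inf_comm]; exact hrel r hrQ
      by_cases hrwP : r ⊓ w ∈ P
      · refine (hrmin ⟨hrwP, ?_⟩ inf_le_left).trans inf_le_right
        rwa [inf_comm r w, ← inf_assoc, inf_eq_left.2 hxw]
      · have h : inv (r ⊓ w) = r := hPP.eq_of_inv_le (hPP.inv_mem hrwS hrwP) hrP
          (by rw [hinv.1]; exact inf_le_left)
        have h' : inv r = r ⊓ w := by rw [← hinv.1 (r ⊓ w), h]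
        exact (hQ.eq_of_inv_le hrQ hwQ (h'.le.trans inf_le_right)).le
    · exact Or.inr (hQ.inv_mem (hPP.mem_sys_s11 hrP) hrQ)
  have hx1S : x ⊔ r ∈ Sv := (hsub x hxS.1 r (hPP.mem_sys_s11 hrP)).resolve_right hrx
  have hx1P := hPP.sup_mem_s11 hxP hrP hx1S
  have hjoin : ∀ z ∈ P, x ⊔ r ≤ z → ∀ Q w, W Q w → x ≤ w → ¬ r ≤ w → z ⊔ inv w ∈ P := by
    intro z hz hxz Q w hw hxw hrw
    have hQ := hW.profile_of Q w hw
    have hrQ : inv r ∈ Q := (hr Q w hw hxw).resolve_left hrw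
    have hzQ : inv z ∈ Q := by
      refine hQ.inv_mem (hPP.mem_sys_s11 hz) fun hzQ => ?_
      have := hQ.eq_of_inv_le hrQ hzQ (by rw [hinv.1]; exact le_sup_right.trans hxz)
      exact hPP.inv_notMem_s11 hrP (this ▸ hz)
    have := hsys _ ((hW.related Q w hw).2 _ hzQ)
    rw [hinv.inv_inf_s11, hinv.1, sup_comm] at this
    exact hPP.sup_mem_s11 hz (hW.inv_mem Q w hw P hP) this
  obtain ⟨z, ⟨hzP, hxz, hzA⟩, hzmax⟩ :=
    (hfinP.subset (Set.sep_subset P fun z => x ⊔ r ≤ z ∧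
      ∀ Q w, W Q w → x ≤ w → r ≤ w → z ≤ w ∨ inv w ≤ z)).exists_maximal
      ⟨x ⊔ r, hx1P, le_rfl, fun Q w _ hxw hrw => Or.inl (sup_le hxw hrw)⟩
  have hzB : ∀ Q w, W Q w → x ≤ w → ¬ r ≤ w → inv w ≤ z := by
    intro Q w hw hxw hrw
    refine le_sup_right.trans
      (hzmax ⟨hjoin z hzP hxz Q w hw hxw hrw, hxz.trans le_sup_left, ?_⟩ le_sup_left)
    intro Q' w' hw' hxw' hrw'
    rcases hzA Q' w' hw' hxw' hrw' with h | h
    · rcases hW.nested Q w Q' w' hw hw' with h' | h' | h'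
      · exact Or.inr ((hinv.2 _ _ h').trans le_sup_right)
      · exact absurd (hrw'.trans h') hrw
      · exact Or.inl (sup_le h h')
    · exact Or.inr (h.trans le_sup_left)
  have hzS : z ∈ SvM inv Sv N := by
    refine hW.mem_SvM hinv (hPP.mem_sys_s11 hzP) fun Q w hw => ?_
    rcases hside Q w hw with h | h
    · by_cases hrw : r ≤ w
      · exact (hzA Q w hw h hrw).imp_right Or.inl
      · exact Or.inr (Or.inl (hzB Q w hw h hrw))
    · exact Or.inr (Or.inl (h.trans (le_sup_left.trans hxz)))
  have hxz' := hmax z ⟨hzP, hzS⟩ (le_sup_left.trans hxz)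
  have hrx' : r ≤ x := (le_sup_right.trans hxz).trans hxz'.ge
  exact hrx (by rw [inf_eq_right.2 hrx']; exact hPP.mem_sys_s11 hrP)

theorem maximal_inv_le (hinv : IsInvol inv) (hfin : Sv.Finite) (hsys : IsSepSys inv Sv)
    (hsub : SubmodularSys Sv) (hW : Uncrossed inv Sv N Qs W) {P P' : Set U} (hP : P ∈ Qs)
    (hP' : P' ∈ Qs) (hne : P ≠ P') {x x' : U} (hx : x ∈ MpOf inv Sv N Qs P)
    (hx' : x' ∈ MpOf inv Sv N Qs P') : inv x' ≤ x := by
  have hnt : ¬ Qs.Subsingleton := fun h => hne (h hP hP')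
  have hPP := hW.profile P hP
  have hside := fun Q w (hw : W Q w) => hW.le_or_inv_le hinv hsys hnt hP hx hw
  have hside' := fun Q w (hw : W Q w) => hW.le_or_inv_le hinv hsys hnt hP' hx' hw
  have hxP' : inv x ∈ P' :=
    (hW.profile P' hP').inv_mem hx.1.1 fun h => hne (hx.2.2.1 P' hP' h).symm
  have hx'P : inv x' ∈ P := hPP.inv_mem hx'.1.1 fun h => hne (hx'.2.2.1 P hP h)
  have hS : x ⊔ inv x' ∈ Sv := by
    have := hsys _ (hW.maximal_inf_mem hinv hfin hsys hsub hnt hP' hx' _ hxP')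
    rwa [hinv.inv_inf_s11, hinv.1, sup_comm] at this
  have hmem := hPP.sup_mem_s11 hx.2.1 hx'P hS
  refine le_sup_right.trans (hx.2.2.2 _ ⟨hmem, hW.mem_SvM hinv hS ?_⟩ le_sup_left).ge
  intro Q w hw
  rcases hside Q w hw with h | h
  · rcases hside' Q w hw with h' | h'
    · exact Or.inr (Or.inl ((hinv.2 _ _ h').trans le_sup_right))
    · exact Or.inl (sup_le h (hinv.inv_le h'))
  · exact Or.inr (Or.inl (h.trans le_sup_left))

theorem isGLB_closelyRelated (hinv : IsInvol inv) (hfin : Sv.Finite) (hsys : IsSepSys inv Sv)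
    (hsub : SubmodularSys Sv) (hW : Uncrossed inv Sv N Qs W) (hnt : ¬ Qs.Subsingleton)
    {P : Set U} (hP : P ∈ QiOf inv Sv N Qs) {y : U} (hy : IsGLB (MpOf inv Sv N Qs P) y) :
    CloselyRelated inv Sv P y ∧ ∀ R ∈ Qs, R ≠ P → inv y ∈ R := by
  obtain ⟨hP, hMne⟩ := hP
  have hPP := hW.profile P hP
  have hMfin : (MpOf inv Sv N Qs P).Finite := hfin.subset fun x hx => hx.1.1
  have hne : hMfin.toFinset.Nonempty := by simpa using hMne
  have hyeq : hMfin.toFinset.inf' hne id = y := by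
    refine IsGLB.unique ?_ hy
    simpa only [Set.Finite.coe_toFinset] using Finset.isGLB_inf' hne
  rw [← hyeq]
  refine Finset.inf'_induction (p := fun y => CloselyRelated inv Sv P y ∧
    ∀ R ∈ Qs, R ≠ P → inv y ∈ R) hne id ?_ ?_
  · rintro a ⟨⟨haP, ha⟩, ha'⟩ b ⟨⟨hbP, hb⟩, hb'⟩
    refine ⟨⟨hPP.inf_mem_s11 hinv haP hbP (ha b hbP), fun r hr => ?_⟩, fun R hR hRP => ?_⟩
    · rw [inf_assoc]
      exact ha _ (hPP.inf_mem_s11 hinv hbP hr (hb r hr))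
    · have := hsys _ (ha b hbP)
      rw [hinv.inv_inf_s11] at this ⊢
      exact (hW.profile R hR).sup_mem_s11 (ha' R hR hRP) (hb' R hR hRP) this
  · intro x hx
    have hx : x ∈ MpOf inv Sv N Qs P := by simpa using hx
    exact ⟨⟨hx.2.1, hW.maximal_inf_mem hinv hfin hsys hsub hnt hP hx⟩, fun R hR hRP =>
      (hW.profile R hR).inv_mem hx.1.1 fun h => hRP (hx.2.2.1 R hR h)⟩

theorem isGLB_inv_le (hinv : IsInvol inv) (hfin : Sv.Finite) (hsys : IsSepSys inv Sv)
    (hsub : SubmodularSys Sv) (hW : Uncrossed inv Sv N Qs W) {P P' : Set U} (hP : P ∈ Qs)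
    (hP' : P' ∈ Qs) (hne : P ≠ P') {y y' : U} (hy : IsGLB (MpOf inv Sv N Qs P) y)
    (hy' : IsGLB (MpOf inv Sv N Qs P') y') : inv y' ≤ y :=
  hy.2 fun _ hx => hinv.inv_le (hy'.2 fun _ hx' => hinv.inv_le
    (hW.maximal_inv_le hinv hfin hsys hsub hP hP' hne hx hx'))

theorem isGLB_le_or_inv_le (hinv : IsInvol inv) (hsys : IsSepSys inv Sv)
    (hW : Uncrossed inv Sv N Qs W) (hnt : ¬ Qs.Subsingleton) {P : Set U} (hP : P ∈ Qs) {y : U}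
    (hy : IsGLB (MpOf inv Sv N Qs P) y) {Q : Set U} {w : U} (hw : W Q w) :
    y ≤ w ∨ inv w ≤ y := by
  by_cases h : ∃ x ∈ MpOf inv Sv N Qs P, x ≤ w
  · obtain ⟨x, hx, hxw⟩ := h
    exact Or.inl ((hy.1 hx).trans hxw)
  · push Not at h
    exact Or.inr (hy.2 fun x hx =>
      (hW.le_or_inv_le hinv hsys hnt hP hx hw).resolve_left (h x hx))

theorem step (hinv : IsInvol inv) (hfin : Sv.Finite) (hsys : IsSepSys inv Sv)
    (hsub : SubmodularSys Sv) (hW : Uncrossed inv Sv N Qs W) (hnt : ¬ Qs.Subsingleton) :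
    Uncrossed inv Sv
      (N ∪ {x | ∃ P ∈ QiOf inv Sv N Qs, ∃ y, IsGLB (MpOf inv Sv N Qs P) y ∧ (x = y ∨ x = inv y)})
      (Qs \ QiOf inv Sv N Qs)
      (fun Q w => W Q w ∨ Q ∈ QiOf inv Sv N Qs ∧ IsGLB (MpOf inv Sv N Qs Q) w) where
  mem_iff n := by
    rw [Set.mem_union, hW.mem_iff]
    constructor
    · rintro (⟨Q, w, hw, h⟩ | ⟨Q, hQ, w, hw, h⟩)
      · exact ⟨Q, w, Or.inl hw, h⟩
      · exact ⟨Q, w, Or.inr ⟨hQ, hw⟩, h⟩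
    · rintro ⟨Q, w, hw | ⟨hQ, hw⟩, h⟩
      · exact Or.inl ⟨Q, w, hw, h⟩
      · exact Or.inr ⟨Q, hQ, w, hw, h⟩
  profile P hP := hW.profile P hP.1
  profile_of Q w := by
    rintro (hw | ⟨hQ, -⟩)
    · exact hW.profile_of Q w hw
    · exact hW.profile Q hQ.1
  related Q w := by
    rintro (hw | ⟨hQ, hw⟩)
    · exact hW.related Q w hw
    · exact (hW.isGLB_closelyRelated hinv hfin hsys hsub hnt hQ hw).1
  inv_mem Q w := by
    rintro (hw | ⟨hQ, hw⟩) R ⟨hR, hR'⟩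
    · exact hW.inv_mem Q w hw R hR
    · exact (hW.isGLB_closelyRelated hinv hfin hsys hsub hnt hQ hw).2 R hR
        fun h => hR' (h ▸ hQ)
  nested Q w Q' w' := by
    rintro (hw | ⟨hQ, hw⟩) (hw' | ⟨hQ', hw'⟩)
    · exact hW.nested Q w Q' w' hw hw'
    · exact Or.inr (hW.isGLB_le_or_inv_le hinv hsys hnt hQ'.1 hw' hw)
    · exact (hW.isGLB_le_or_inv_le hinv hsys hnt hQ.1 hw hw').imp_right
        fun h => Or.inr (hinv.inv_le h)
    · by_cases h : Q = Q'
      · subst h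
        exact Or.inl (hw.unique hw').le
      · exact Or.inr (Or.inr
          (hW.isGLB_inv_le hinv hfin hsys hsub hQ'.1 hQ.1 (Ne.symm h) hw' hw))

end Uncrossed

/-- `w` is the separation chosen for the profile `Q` in the step of the construction that turns
stage `k` into stage `k + 1`. -/
def ChosenAt (inv : U → U) (Sv : Set U) (Ps : Set (Set U)) (k : ℕ) (Q : Set U) (w : U) : Prop :=
  Q ∈ QiOf inv Sv (constrStep inv Sv Ps k).1 (constrStep inv Sv Ps k).2 ∧
    IsGLB (MpOf inv Sv (constrStep inv Sv Ps k).1 (constrStep inv Sv Ps k).2 Q) w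

section Construction

variable {inv : U → U} {Sv : Set U} {Ps : Set (Set U)}

theorem constrStep_snd_antitone : Antitone fun k => (constrStep inv Sv Ps k).2 :=
  antitone_nat_of_succ_le fun _ => Set.sdiff_subset

theorem ChosenAt.notMem_constrStep {k l : ℕ} {Q : Set U} {w : U} (h : ChosenAt inv Sv Ps k Q w)
    (hkl : k < l) : Q ∉ (constrStep inv Sv Ps l).2 :=
  fun hQ => (constrStep_snd_antitone (Nat.succ_le_of_lt hkl) hQ).2 h.1

theorem uncrossed_constrStep (hinv : IsInvol inv) (hfin : Sv.Finite) (hsys : IsSepSys inv Sv)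
    (hsub : SubmodularSys Sv) (hPs : ∀ P ∈ Ps, IsProfile inv Sv P) :
    ∀ k, (∀ l < k, ¬ (constrStep inv Sv Ps l).2.Subsingleton) →
      Uncrossed inv Sv (constrStep inv Sv Ps k).1 (constrStep inv Sv Ps k).2
        (fun Q w => ∃ l < k, ChosenAt inv Sv Ps l Q w)
  | 0, _ => by
    constructor <;> simp +contextual [constrStep, hPs]
  | k + 1, hk => by
    have h := (uncrossed_constrStep hinv hfin hsys hsub hPs k
      fun l hl => hk l (Nat.lt_succ_of_lt hl)).step hinv hfin hsys hsub (hk k k.lt_succ_self)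
    convert h using 3 with Q w
    · rfl
    · rfl
    · simp only [Nat.lt_succ_iff_lt_or_eq, or_and_right, exists_or, exists_eq_left, ChosenAt]

end Construction

end SepSys

open SepSys

theorem inessential_nodes_of_canonicalN_closely_related {U : Type*} [Lattice U] (inv : U → U) (Sv : Set U)
    (hinv : IsInvol inv) (hfin : Sv.Finite) (hsys : IsSepSys inv Sv)
    (hsub : SubmodularSys Sv)
    (Ps : Set (Set U)) (hPs : ∀ P ∈ Ps, IsProfile inv Sv P) :
    ∀ σ : Set U, IsNode inv (canonicalN inv Sv Ps) σ →
      (∀ P ∈ Ps, ¬ σ ⊆ P) →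
      ∀ s ∈ σ, ∃ P ∈ Ps, CloselyRelated inv Sv P (inv s) := by
  intro σ hσ hiness s hs
  obtain ⟨⟨hσN, -, hσstar⟩, O, hO, -, hσO⟩ := hσ
  have hnt : ∀ k < stopIndex inv Sv Ps, ¬ (constrStep inv Sv Ps k).2.Subsingleton :=
    fun k hk => Nat.notMem_of_lt_sInf hk
  have hWat : ∀ k ≤ stopIndex inv Sv Ps, Uncrossed inv Sv (constrStep inv Sv Ps k).1
      (constrStep inv Sv Ps k).2 (fun Q w => ∃ l < k, ChosenAt inv Sv Ps l Q w) :=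
    fun k hk => uncrossed_constrStep hinv hfin hsys hsub hPs k
      fun l hl => hnt l (hl.trans_le hk)
  have hW := hWat _ le_rfl
  have hPsk : ∀ k, (constrStep inv Sv Ps k).2 ⊆ Ps :=
    fun k => constrStep_snd_antitone (Nat.zero_le k)
  have hrel : ∀ k < stopIndex inv Sv Ps, ∀ Q w, ChosenAt inv Sv Ps k Q w →
      CloselyRelated inv Sv Q w ∧ ∀ R ∈ (constrStep inv Sv Ps k).2, R ≠ Q → inv w ∈ R :=
    fun k hk Q w h =>
      (hWat k hk.le).isGLB_closelyRelated hinv hfin hsys hsub (hnt k hk) h.1 h.2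
  obtain ⟨P, y, ⟨k, hk, hPy⟩, hsy⟩ := (hW.mem_iff s).1 (hσN hs)
  have hPk := hPy.1.1
  have hP := hPsk k hPk
  rcases hsy with rfl | rfl
  swap
  · exact ⟨P, hP, by rw [hinv.1]; exact (hrel k hk P y hPy).1⟩
  obtain ⟨⟨hsP, -⟩, hsex⟩ := hrel k hk P s hPy
  obtain ⟨t, ht, htP⟩ := Set.not_subset.1 (hiness P hP)
  have hts : t ≠ s := fun h => htP (h ▸ hsP)
  have hle : t ≤ inv s := hσstar t ht s hs hts
  obtain ⟨Q, w, ⟨l, hl, hQw⟩, htw⟩ := (hW.mem_iff t).1 (hσN ht)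
  have hQl := hQw.1.1
  have hQ := hPsk l hQl
  obtain ⟨hwrel, hwex⟩ := hrel l hl Q w hQw
  by_cases hQP : Q = P
  · subst hQP
    have hkl : k = l := by
      rcases lt_trichotomy k l with h | h | h
      · exact absurd hQl (hPy.notMem_constrStep h)
      · exact h
      · exact absurd hPk (hQw.notMem_constrStep h)
    subst hkl
    obtain rfl := hPy.2.unique hQw.2
    have hti : t = inv s := htw.resolve_left hts
    subst hti
    rw [hσO] at hs ht
    exact absurd (hO.2.2 s hs.1 ht.1) hts
  have hcommon : ∀ R ∈ Ps, w = t → inv w ∈ R → inv s ∈ R → w = inv s := by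
    rintro R hR rfl hwR hsR
    by_contra hne
    have := (hPs R hR).eq_of_inv_le hwR hsR (by rw [hinv.1]; exact hle)
    exact hts (by rw [← hinv.1 w, this, hinv.1])
  suffices w = inv s from ⟨Q, hQ, this ▸ hwrel⟩
  rcases lt_trichotomy k l with h | h | h
  · have hsQ : inv s ∈ Q := hsex Q (constrStep_snd_antitone h.le hQl) hQP
    rcases htw with rfl | rfl
    · obtain ⟨R, hR, hRQ⟩ := (Set.not_subsingleton_iff.1 (hnt l hl)).exists_ne Q
      refine hcommon R (hPsk l hR) rfl (hwex R hR hRQ) (hsex R (constrStep_snd_antitone h.le hR) ?_)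
      rintro rfl
      exact hPy.notMem_constrStep h hR
    · have := (hPs Q hQ).eq_of_inv_le hsQ hwrel.1 (by rw [hinv.1]; exact hinv.le_iff.1 hle)
      exact this.symm
  · subst h
    have hwP : inv w ∈ P := hwex P hPk (Ne.symm hQP)
    rcases htw with rfl | rfl
    · refine le_antisymm hle (hinv.inv_le ?_)
      exact (hWat k hk.le).isGLB_inv_le hinv hfin hsys hsub hPk hQl (Ne.symm hQP) hPy.2 hQw.2
    · exact absurd hwP htP
  · have hwP : inv w ∈ P := hwex P (constrStep_snd_antitone h.le hPk) (Ne.symm hQP)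
    rcases htw with rfl | rfl
    · obtain ⟨R, hR, hRP⟩ := (Set.not_subsingleton_iff.1 (hnt k hk)).exists_ne P
      refine hcommon R (hPsk k hR) rfl (hwex R (constrStep_snd_antitone h.le hR) ?_) (hsex R hR hRP)
      rintro rfl
      exact hQw.notMem_constrStep h hR
    · exact absurd hwP htP
end
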